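/- Let F be an antitone exhaustive filtration on a K-vector space V and G an antitone filtration on a K-vector space W. Let φ : R(V,F) → K[x,x⁻¹] ⊗_K W be a K[x]-linear map whose range is contained in R(W,G) and which is grading-preserving, in the sense that for every m ∈ ℤ, φ maps R(V,F) ⊓ range(μ_m : V → K[x,x⁻¹]⊗V) into range(μ_m : W → K[x,x⁻¹]⊗W). Then there exists a unique K-linear map f : V → W with Submodule.map f (F i) ≤ G i for all i ∈ ℤ such that φ coincides with the restriction of id ⊗ f to R(V,F). -/

import Mathlib

open Polynomial LaurentPolynomial TensorProduct DirectSum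

noncomputable instance (K : Type*) [Field K] :
    IsScalarTower K (Polynomial K) (LaurentPolynomial K) :=
  IsScalarTower.of_algebraMap_eq fun c => by
    simp [LaurentPolynomial.algebraMap_eq_toLaurent]

noncomputable instance (K : Type*) [Field K] :
    SMulCommClass K (Polynomial K) (LaurentPolynomial K) :=
  IsScalarTower.to_smulCommClass

noncomputable instance (priority := 1100) (K : Type*) [Field K] (V : Type*) [AddCommGroup V]
    [Module K V] : AddCommGroup (LaurentPolynomial K ⊗[K] V) :=
  TensorProduct.addCommGroup

/-- The `K`-linear map `μ m : v ↦ x^m ⊗ v` from `V` to `K[x,x⁻¹] ⊗[K] V`. -/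
noncomputable def mu (K : Type*) [Field K] (V : Type*) [AddCommGroup V] [Module K V] (m : ℤ) :
    V →ₗ[K] LaurentPolynomial K ⊗[K] V :=
  TensorProduct.mk K (LaurentPolynomial K) V (LaurentPolynomial.T m)

/-- The Rees module of a filtration `F`: the `K[x]`-submodule of `K[x,x⁻¹] ⊗[K] V`
generated by the elements `x^(-i) ⊗ v` with `i : ℤ` and `v ∈ F i`. -/
noncomputable def ReesModule (K : Type*) [Field K] (V : Type*) [AddCommGroup V] [Module K V]
    (F : ℤ → Submodule K V) : Submodule (Polynomial K) (LaurentPolynomial K ⊗[K] V) :=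
  Submodule.span (Polynomial K)
    {z | ∃ (i : ℤ) (v : V), v ∈ F i ∧ z = LaurentPolynomial.T (-i) ⊗ₜ[K] v}

section ReesModuleAux

variable {K : Type*} [Field K] {V : Type*} [AddCommGroup V] [Module K V]

/-- The coefficient of `x^n` of an element of `K[x,x⁻¹] ⊗[K] V`. -/
noncomputable def tensorCoeff (K : Type*) [Field K] (V : Type*) [AddCommGroup V] [Module K V]
    (n : ℤ) : LaurentPolynomial K ⊗[K] V →ₗ[K] V :=
  TensorProduct.lift
    { toFun := fun p => p.coeff n • LinearMap.id
      map_add' := fun p q => by simp [add_smul]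
      map_smul' := fun c p => by simp [mul_smul] }

theorem tensorCoeff_tmul (n : ℤ) (p : LaurentPolynomial K) (v : V) :
    tensorCoeff K V n (p ⊗ₜ[K] v) = p.coeff n • v := by
  simp [tensorCoeff]

theorem tensorCoeff_T_tmul (n m : ℤ) (v : V) :
    tensorCoeff K V n (LaurentPolynomial.T m ⊗ₜ[K] v) = if m = n then v else 0 := by
  rw [tensorCoeff_tmul, LaurentPolynomial.T_apply, ite_smul, one_smul, zero_smul]

theorem T_tmul_injective (m : ℤ) :
    Function.Injective fun v : V => (LaurentPolynomial.T m : LaurentPolynomial K) ⊗ₜ[K] v := by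
  intro v w h
  simpa [tensorCoeff_T_tmul] using congrArg (tensorCoeff K V m) h

theorem X_pow_smul_T_tmul (n : ℕ) (m : ℤ) (v : V) :
    (X ^ n : K[X]) • ((LaurentPolynomial.T m : LaurentPolynomial K) ⊗ₜ[K] v) =
      LaurentPolynomial.T (m + n) ⊗ₜ[K] v := by
  rw [TensorProduct.smul_tmul', Algebra.smul_def, LaurentPolynomial.algebraMap_eq_toLaurent,
    Polynomial.toLaurent_X_pow, ← LaurentPolynomial.T_add, add_comm]

theorem C_smul_tensor (c : K) (z : LaurentPolynomial K ⊗[K] V) :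
    (C c : K[X]) • z = c • z := by
  induction z with
  | zero => simp
  | add a b ha hb => rw [smul_add, smul_add, ha, hb]
  | tmul p v =>
    rw [TensorProduct.smul_tmul', TensorProduct.smul_tmul', ← Polynomial.algebraMap_eq,
      algebraMap_smul]

theorem tensorCoeff_X_smul (n : ℤ) (z : LaurentPolynomial K ⊗[K] V) :
    tensorCoeff K V n ((X : K[X]) • z) = tensorCoeff K V (n - 1) z := by
  induction z with
  | zero => simp
  | add a b ha hb => rw [smul_add, map_add, map_add, ha, hb]
  | tmul p v =>
    induction p using LaurentPolynomial.induction_on' with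
    | add p q hp hq => rw [TensorProduct.add_tmul, smul_add, map_add, map_add, hp, hq]
    | C_mul_T m c =>
      have h : (LaurentPolynomial.C c * LaurentPolynomial.T m : LaurentPolynomial K) ⊗ₜ[K] v =
          LaurentPolynomial.T m ⊗ₜ[K] (c • v) := by
        rw [← LaurentPolynomial.smul_eq_C_mul, TensorProduct.smul_tmul]
      rw [h, ← pow_one (X : K[X]), X_pow_smul_T_tmul, tensorCoeff_T_tmul, tensorCoeff_T_tmul]
      simp only [Nat.cast_one, eq_sub_iff_add_eq]

theorem T_tmul_mem_reesModule {F : ℤ → Submodule K V} {i : ℤ} {v : V} (hv : v ∈ F i) :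
    LaurentPolynomial.T (-i) ⊗ₜ[K] v ∈ ReesModule K V F :=
  Submodule.subset_span ⟨i, v, hv, rfl⟩

theorem tensorCoeff_mem_of_mem_reesModule {F : ℤ → Submodule K V} (hF : Antitone F)
    {z : LaurentPolynomial K ⊗[K] V} (hz : z ∈ ReesModule K V F) (i : ℤ) :
    tensorCoeff K V (-i) z ∈ F i := by
  induction hz using Submodule.span_induction generalizing i with
  | mem z hz =>
    obtain ⟨j, v, hv, rfl⟩ := hz
    rw [tensorCoeff_T_tmul]
    split_ifs with h
    · rwa [← neg_injective h]
    · exact zero_mem _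
  | zero => rw [map_zero]; exact zero_mem _
  | add a b _ _ ha hb => rw [map_add]; exact add_mem (ha i) (hb i)
  | smul p z _ hz =>
    induction p using Polynomial.induction_on generalizing i with
    | C c => rw [C_smul_tensor, map_smul]; exact (F i).smul_mem c (hz i)
    | add p q hp hq => rw [add_smul, map_add]; exact add_mem (hp i) (hq i)
    | monomial n c h =>
      rw [pow_succ', mul_left_comm, mul_smul, tensorCoeff_X_smul,
        show -i - 1 = -(i + 1) by ring]
      exact hF (by lia) (h (i + 1))

end ReesModuleAux

/-- a `K[x]`-linear, grading-preserving map `φ` from `R(V,F)` into `R(W,G)`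
is induced by a unique filtered `K`-linear map `f : V → W` (i.e. `φ = (id ⊗ f)|_{R(V,F)}`). -/
theorem reesModule_hom_eq_baseChange_of_grading_preserving
    (K : Type*) [Field K] (V : Type*) [AddCommGroup V] [Module K V]
    (W : Type*) [AddCommGroup W] [Module K W]
    (F : ℤ → Submodule K V) (hF : Antitone F) (hexh : ∃ i : ℤ, F i = ⊤)
    (G : ℤ → Submodule K W) (hG : Antitone G)
    (φ : ↥(ReesModule K V F) →ₗ[Polynomial K] LaurentPolynomial K ⊗[K] W)
    (hrange : ∀ z : ↥(ReesModule K V F), φ z ∈ ReesModule K W G)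
    (hgrade : ∀ (m : ℤ) (z : ↥(ReesModule K V F)),
      (z : LaurentPolynomial K ⊗[K] V) ∈ LinearMap.range (mu K V m) →
        φ z ∈ LinearMap.range (mu K W m)) :
    ∃! f : V →ₗ[K] W, (∀ i : ℤ, (F i).map f ≤ G i) ∧
      ∀ z : ↥(ReesModule K V F),
        φ z = f.baseChange (LaurentPolynomial K) (z : LaurentPolynomial K ⊗[K] V) := by
  obtain ⟨i₀, hi₀⟩ := hexh
  have hmem (v : V) : LaurentPolynomial.T (-i₀) ⊗ₜ[K] v ∈ ReesModule K V F :=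
    T_tmul_mem_reesModule (by rw [hi₀]; trivial)
  let f : V →ₗ[K] W :=
    { toFun := fun v => tensorCoeff K W (-i₀) (φ ⟨_, hmem v⟩)
      map_add' := fun v w => by
        rw [← map_add, ← map_add]
        congr 2
        exact Subtype.ext (TensorProduct.tmul_add _ _ _)
      map_smul' := fun c v => by
        rw [RingHom.id_apply, ← map_smul, ← C_smul_tensor, ← map_smul]
        congr 2
        refine Subtype.ext ?_
        rw [Submodule.coe_smul, C_smul_tensor]
        exact TensorProduct.tmul_smul _ _ _ }
  have hgen (i : ℤ) (v : V) (hv : LaurentPolynomial.T (-i) ⊗ₜ[K] v ∈ ReesModule K V F) :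
      φ ⟨_, hv⟩ = LaurentPolynomial.T (-i) ⊗ₜ[K] f v := by
    obtain ⟨w, hw⟩ := hgrade (-i) ⟨_, hv⟩ ⟨v, rfl⟩
    obtain ⟨w₀, hw₀⟩ := hgrade (-i₀) ⟨_, hmem v⟩ ⟨v, rfl⟩
    change LaurentPolynomial.T (-i) ⊗ₜ[K] w = _ at hw
    change LaurentPolynomial.T (-i₀) ⊗ₜ[K] w₀ = _ at hw₀
    have hf : f v = w₀ := by
      change tensorCoeff K W (-i₀) (φ ⟨_, hmem v⟩) = w₀
      rw [← hw₀, tensorCoeff_T_tmul, if_pos rfl]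
    obtain ⟨a, b, hab⟩ : ∃ a b : ℕ, -i + a = -i₀ + b :=
      ⟨(i - i₀).toNat, (i₀ - i).toNat, by lia⟩
    have key : (X ^ a : K[X]) • (⟨_, hv⟩ : ReesModule K V F) = (X ^ b : K[X]) • ⟨_, hmem v⟩ := by
      refine Subtype.ext ?_
      rw [Submodule.coe_smul, Submodule.coe_smul, X_pow_smul_T_tmul, X_pow_smul_T_tmul, hab]
    have := congrArg φ key
    rw [map_smul, map_smul, ← hw, ← hw₀, X_pow_smul_T_tmul, X_pow_smul_T_tmul, hab] at this
    rw [← hw, hf, T_tmul_injective _ this]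
  refine ⟨f, ⟨?_, ?_⟩, ?_⟩
  · rintro i _ ⟨v, hv, rfl⟩
    have h := tensorCoeff_mem_of_mem_reesModule hG (hrange ⟨_, T_tmul_mem_reesModule hv⟩) i
    rwa [hgen, tensorCoeff_T_tmul, if_pos rfl] at h
  · rintro ⟨z, hz⟩
    induction hz using Submodule.span_induction with
    | mem z hz =>
      obtain ⟨i, v, hv, rfl⟩ := hz
      exact (hgen i v (T_tmul_mem_reesModule hv)).trans (LinearMap.baseChange_tmul _ _ _).symm
    | zero => exact (map_zero φ).trans (map_zero _).symm
    | add a b ha hb iha ihb =>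
      rw [map_add, ← iha, ← ihb, ← map_add]
      rfl
    | smul p z hz ih =>
      rw [LinearMap.map_smul_of_tower, ← ih, ← map_smul]
      rfl
  · rintro g ⟨-, hg⟩
    ext v
    refine T_tmul_injective (K := K) (-i₀) ?_
    change _ = LaurentPolynomial.T (-i₀) ⊗ₜ[K] f v
    rw [← hgen i₀ v (hmem v), hg, LinearMap.baseChange_tmul]
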